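/- Let A be a P-module in ℝ^d. Then the boundary ∂A is a connected subset of ℝ^d. -/

import Mathlib

open MeasureTheory

section ConeTranslates

variable {E : Type*} [NormedAddCommGroup E] [NormedSpace ℝ E]

/-- A convex set containing `0` whose differences exhaust a finite-dimensional space has nonempty
interior. -/
theorem Convex.interior_nonempty_of_forall_eq_sub [FiniteDimensional ℝ E] {P : Set E}
    (hP : Convex ℝ P) (h0 : (0 : E) ∈ P) (hspan : ∀ v : E, ∃ x ∈ P, ∃ y ∈ P, v = x - y) :
    (interior P).Nonempty := by
  rw [hP.interior_nonempty_iff_affineSpan_eq_top, eq_top_iff]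
  intro v _
  obtain ⟨x, hx, y, hy, rfl⟩ := hspan v
  simpa using AffineSubspace.vadd_mem_of_mem_direction
    (AffineSubspace.vsub_mem_direction (subset_affineSpan ℝ P hx) (subset_affineSpan ℝ P hy))
    (subset_affineSpan ℝ P h0)

/-- An interior point `e` of a cone absorbs every vector, at a rate linear in its norm. -/
theorem exists_forall_add_smul_mem_of_mem_interior {P : Set E}
    (hcone : ∀ x ∈ P, ∀ t : ℝ, 0 ≤ t → t • x ∈ P) {e : E} (he : e ∈ interior P) :
    ∃ K : NNReal, ∀ (v : E) (s : ℝ), K * ‖v‖ ≤ s → v + s • e ∈ P := by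
  obtain ⟨r, hr, hball⟩ :=
    Metric.nhds_basis_closedBall.mem_iff.1 (mem_interior_iff_mem_nhds.1 he)
  refine ⟨⟨r⁻¹, by positivity⟩, fun v s hs => ?_⟩
  replace hs : r⁻¹ * ‖v‖ ≤ s := hs
  have hs0 : 0 ≤ s := le_trans (by positivity) hs
  rcases hs0.eq_or_lt with rfl | hpos
  · have hv : ‖v‖ = 0 := by
      rw [inv_mul_le_iff₀ hr, mul_zero] at hs
      exact le_antisymm hs (norm_nonneg v)
    simpa [norm_eq_zero.1 hv] using hcone e (interior_subset he) 0 le_rfl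
  · have hmem : e + s⁻¹ • v ∈ P := by
      apply hball
      rw [mem_closedBall_iff_norm, add_sub_cancel_left, norm_smul, norm_inv,
        Real.norm_of_nonneg hs0, inv_mul_le_iff₀ hpos]
      rwa [inv_mul_le_iff₀ hr, mul_comm] at hs
    simpa [smul_add, smul_smul, hpos.ne', add_comm] using hcone _ hmem s hs0

/-- A proper nonempty closed set stable under adding elements of a cone is, along the direction of
an interior point of the cone, the epigraph of a Lipschitz function. -/
theorem exists_lipschitzWith_forall_add_smul_mem_iff {P A : Set E}
    (hcone : ∀ x ∈ P, ∀ t : ℝ, 0 ≤ t → t • x ∈ P) {e : E} (he : e ∈ interior P)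
    (hclosed : IsClosed A) (hproper : A ≠ Set.univ) (hne : A.Nonempty)
    (hadd : ∀ b ∈ A, ∀ p ∈ P, b + p ∈ A) :
    ∃ (K : NNReal) (f : E → ℝ), LipschitzWith K f ∧ ∀ x (t : ℝ), x + t • e ∈ A ↔ f x ≤ t := by
  obtain ⟨K, hK⟩ := exists_forall_add_smul_mem_of_mem_interior hcone he
  have move : ∀ (x y : E) (s t : ℝ), x + s • e ∈ A → K * ‖y - x‖ ≤ t - s → y + t • e ∈ A := by
    intro x y s t hx hst
    convert hadd _ hx _ (hK _ _ hst) using 1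
    module
  obtain ⟨a, ha⟩ := hne
  obtain ⟨z, hz⟩ := (Set.ne_univ_iff_exists_notMem A).1 hproper
  let S : E → Set ℝ := fun x => {t | x + t • e ∈ A}
  have hSne : ∀ x, (S x).Nonempty := fun x =>
    ⟨K * ‖x - a‖, move a x 0 _ (by simpa using ha) (by simp)⟩
  have hSbdd : ∀ x, BddBelow (S x) := fun x => by
    refine ⟨-(K * ‖z - x‖), fun t ht => ?_⟩
    by_contra! hlt
    exact hz (by simpa using move x z t 0 ht (by linarith))
  have hSmem : ∀ x, sInf (S x) ∈ S x := fun x =>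
    IsClosed.csInf_mem (hclosed.preimage (by fun_prop)) (hSne x) (hSbdd x)
  refine ⟨K, fun x => sInf (S x), LipschitzWith.of_le_add_mul K fun x y => ?_, fun x t =>
    ⟨fun ht => csInf_le (hSbdd x) ht, fun ht => move x x _ t (hSmem x) (by simpa using ht)⟩⟩
  exact csInf_le (hSbdd x) (move y x _ _ (hSmem y) (by simp [dist_eq_norm]))

/-- The boundary of an epigraph is the graph. -/
theorem frontier_eq_range_of_forall_add_smul_mem_iff {A : Set E} {e : E} {f : E → ℝ}
    (hf : Continuous f) (hA : ∀ x (t : ℝ), x + t • e ∈ A ↔ f x ≤ t) :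
    frontier A = Set.range fun x => x + f x • e := by
  have hA0 : A = {x | f x ≤ 0} := by
    ext x
    simpa using hA x 0
  apply Set.Subset.antisymm
  · intro y hy
    rw [hA0] at hy
    have hy0 : f y = 0 := frontier_le_subset_eq hf continuous_const hy
    exact ⟨y, by simp [hy0]⟩
  · rintro _ ⟨x, rfl⟩
    refine ⟨subset_closure ((hA x _).2 le_rfl), fun hx => ?_⟩
    have hline : Continuous fun t : ℝ => x + t • e := by fun_prop
    have hev : ∀ᶠ t in nhds (f x), x + t • e ∈ A :=
      hline.continuousAt.eventually (mem_interior_iff_mem_nhds.1 hx)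
    obtain ⟨t, hlt, ht⟩ := hev.exists_lt
    exact hlt.not_ge ((hA x t).1 ht)

end ConeTranslates

/-- For a `P`-module `A` in `ℝ^d`, the boundary `∂A` is connected. -/
theorem frontier_connected
    (d : ℕ) (P A : Set (EuclideanSpace ℝ (Fin d)))
    (hPclosed : IsClosed P) (hPconvex : Convex ℝ P)
    (hPcone : ∀ x ∈ P, ∀ t : ℝ, 0 ≤ t → t • x ∈ P)
    (hPspan : ∀ v : EuclideanSpace ℝ (Fin d), ∃ x ∈ P, ∃ y ∈ P, v = x - y)
    (hPpointed : P ∩ (-P) = {0})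
    (hAclosed : IsClosed A) (hAproper : A ≠ Set.univ)
    (hAzero : (0 : EuclideanSpace ℝ (Fin d)) ∈ A)
    (hAmod : ∀ b ∈ A, ∀ p ∈ P, b + p ∈ A) :
    IsConnected (frontier A) := by
  have hP0 : (0 : EuclideanSpace ℝ (Fin d)) ∈ P :=
    (hPpointed.symm.subset (Set.mem_singleton _)).1
  obtain ⟨e, he⟩ := hPconvex.interior_nonempty_of_forall_eq_sub hP0 hPspan
  obtain ⟨K, f, hf, hA⟩ := exists_lipschitzWith_forall_add_smul_mem_iff hPcone he hAclosed
    hAproper ⟨0, hAzero⟩ hAmod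
  rw [frontier_eq_range_of_forall_add_smul_mem_iff hf.continuous hA]
  have hcont := hf.continuous
  exact isConnected_range (by fun_prop)
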